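/- Let k be a field, let n and s be positive integers, and let m be the char(k)-free part of n. Then s_n(k[[x₁,…,x_s]]) = s_m(k), where k[[x₁,…,x_s]] is the ring of formal power series in s variables over k. Moreover, if s_n(k) < ∞, then w_n(k[[x₁,…,x_s]]) = max{w_m(k), s_m(k)+1} if m > 1, and w_n(k[[x₁,…,x_s]]) = 1 if m = 1. -/

import Mathlib

/-- `a` is a sum of finitely many `n`-th powers in `R`. -/
def IsSumOfPowers (R : Type*) [CommRing R] (n : ℕ) (a : R) : Prop :=
  ∃ l : ℕ, ∃ x : Fin l → R, a = ∑ i, x i ^ n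

/-- The `n`-length of `a ∈ R`: the least positive integer `g` such that `a` is a sum of
`g` `n`-th powers of elements of `R`, or `∞` if no such `g` exists. -/
noncomputable def nLength (R : Type*) [CommRing R] (n : ℕ) (a : R) : ℕ∞ :=
  sInf {g : ℕ∞ | ∃ l : ℕ, g = l ∧ 0 < l ∧ ∃ x : Fin l → R, a = ∑ i, x i ^ n}

/-- The `n`-th level of `R`: `s_n(R) = ℓ_n(-1)`. -/
noncomputable def level (R : Type*) [CommRing R] (n : ℕ) : ℕ∞ :=
  nLength R n (-1)

/-- The `n`-th Waring number of `R`: the least positive integer `g` such that every element of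
`R` which is a sum of finitely many `n`-th powers is a sum of at most `g` `n`-th powers,
or `∞` if no such `g` exists. -/
noncomputable def waring (R : Type*) [CommRing R] (n : ℕ) : ℕ∞ :=
  sInf {g : ℕ∞ | ∃ l : ℕ, g = l ∧ 0 < l ∧
    ∀ a : R, IsSumOfPowers R n a → nLength R n a ≤ l}

/-- `m` is the `p`-free part of `n`: if `p = 0` then `m = n`, and otherwise `n = p ^ j * m`
with `p ∤ m`. -/
def IsFreePart (p n m : ℕ) : Prop :=
  (p = 0 ∧ m = n) ∨ (p ≠ 0 ∧ ¬ p ∣ m ∧ ∃ j : ℕ, n = p ^ j * m)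

/-- `a` is a sum of exactly `l` `n`-th powers in `R`. -/
def IsSumOfNPowers (R : Type*) [CommRing R] (n l : ℕ) (a : R) : Prop :=
  ∃ x : Fin l → R, a = ∑ i, x i ^ n

section Length

variable {R : Type*} [CommRing R] {n : ℕ}

theorem IsSumOfNPowers.succ {l : ℕ} {a : R} (hn : 0 < n) (h : IsSumOfNPowers R n l a) :
    IsSumOfNPowers R n (l + 1) a := by
  obtain ⟨x, rfl⟩ := h
  exact ⟨Fin.cons 0 x, by simp [Fin.sum_univ_succ, hn.ne']⟩

theorem IsSumOfNPowers.mono {l l' : ℕ} {a : R} (hn : 0 < n) (hl : l ≤ l')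
    (h : IsSumOfNPowers R n l a) : IsSumOfNPowers R n l' a := by
  induction hl with
  | refl => exact h
  | step _ ih => exact ih.succ hn

theorem IsSumOfNPowers.add_pow {l : ℕ} {a : R} (b : R) (h : IsSumOfNPowers R n l a) :
    IsSumOfNPowers R n (l + 1) (b ^ n + a) := by
  obtain ⟨x, rfl⟩ := h
  exact ⟨Fin.cons b x, by simp [Fin.sum_univ_succ]⟩

theorem IsSumOfNPowers.map {S : Type*} [CommRing S] {l : ℕ} {a : R} (f : R →+* S)
    (h : IsSumOfNPowers R n l a) : IsSumOfNPowers S n l (f a) := by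
  obtain ⟨x, rfl⟩ := h
  exact ⟨fun i => f (x i), by simp⟩

theorem exists_nLength_eq {a : R} (h : nLength R n a ≠ ⊤) :
    ∃ l : ℕ, nLength R n a = l ∧ 0 < l ∧ IsSumOfNPowers R n l a := by
  refine csInf_mem (s := {g : ℕ∞ | ∃ l : ℕ, g = l ∧ 0 < l ∧ ∃ x : Fin l → R, a = ∑ i, x i ^ n})
    (Set.nonempty_iff_ne_empty.2 fun he => h ?_)
  rw [nLength, he, sInf_empty]

theorem nLength_le {a : R} {l : ℕ} (hl : 0 < l) (h : IsSumOfNPowers R n l a) :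
    nLength R n a ≤ l :=
  sInf_le ⟨l, rfl, hl, h⟩

theorem nLength_le_iff {a : R} {l : ℕ} (hn : 0 < n) (hl : 0 < l) :
    nLength R n a ≤ l ↔ IsSumOfNPowers R n l a := by
  refine ⟨fun h => ?_, nLength_le hl⟩
  obtain ⟨l', h₁, -, h₂⟩ := exists_nLength_eq (ne_top_of_le_ne_top (ENat.natCast_ne_top l) h)
  exact h₂.mono hn (by rwa [h₁, Nat.cast_le] at h)

theorem nLength_congr {S : Type*} [CommRing S] {n' : ℕ} {a : R} {b : S}
    (h : ∀ l, IsSumOfNPowers R n l a ↔ IsSumOfNPowers S n' l b) :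
    nLength R n a = nLength S n' b := by
  unfold nLength
  congr 1
  ext g
  exact exists_congr fun l => and_congr_right fun _ => and_congr_right fun _ => h l

theorem exists_waring_eq (hn : 0 < n) (h : waring R n ≠ ⊤) :
    ∃ l : ℕ, waring R n = l ∧ 0 < l ∧ ∀ a, IsSumOfPowers R n a → IsSumOfNPowers R n l a := by
  obtain ⟨l, h₁, h₂, h₃⟩ : waring R n ∈ {g : ℕ∞ | ∃ l : ℕ, g = l ∧ 0 < l ∧
      ∀ a : R, IsSumOfPowers R n a → nLength R n a ≤ l} := by
    refine csInf_mem (Set.nonempty_iff_ne_empty.2 fun he => h ?_)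
    rw [waring, he, sInf_empty]
  exact ⟨l, h₁, h₂, fun a ha => (nLength_le_iff hn h₂).1 (h₃ a ha)⟩

theorem waring_le {l : ℕ} (hl : 0 < l)
    (h : ∀ a, IsSumOfPowers R n a → IsSumOfNPowers R n l a) : waring R n ≤ l :=
  sInf_le ⟨l, rfl, hl, fun a ha => nLength_le hl (h a ha)⟩

theorem one_le_waring : 1 ≤ waring R n := by
  refine le_sInf ?_
  rintro _ ⟨l, rfl, hl, -⟩
  exact_mod_cast hl

end Length

section Frobenius

variable {R : Type*} [CommRing R] (p : ℕ) [ExpChar R p] {j m : ℕ}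

theorem isSumOfNPowers_expChar_pow_mul_iff {l : ℕ} {a : R} :
    IsSumOfNPowers R (p ^ j * m) l a ↔ ∃ b, b ^ p ^ j = a ∧ IsSumOfNPowers R m l b := by
  constructor
  · rintro ⟨x, rfl⟩
    exact ⟨_, by simp only [sum_pow_char_pow, ← pow_mul, mul_comm], x, rfl⟩
  · rintro ⟨_, rfl, x, rfl⟩
    exact ⟨x, by simp only [sum_pow_char_pow, ← pow_mul, mul_comm]⟩

variable [IsReduced R]

theorem isSumOfNPowers_expChar_pow_iff {l : ℕ} {b : R} :
    IsSumOfNPowers R (p ^ j * m) l (b ^ p ^ j) ↔ IsSumOfNPowers R m l b := by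
  rw [isSumOfNPowers_expChar_pow_mul_iff]
  refine ⟨?_, fun h => ⟨b, rfl, h⟩⟩
  rintro ⟨c, hc, h⟩
  rwa [iterateFrobenius_inj R p j hc] at h

theorem level_expChar_pow_mul : level R (p ^ j * m) = level R m := by
  refine nLength_congr fun l => ?_
  have h : (-1 : R) ^ p ^ j = -1 := by
    have := map_neg (iterateFrobenius R p j) 1
    simpa [iterateFrobenius_def] using this
  rw [← isSumOfNPowers_expChar_pow_iff p (j := j) (m := m) (b := -1), h]

theorem waring_expChar_pow_mul : waring R (p ^ j * m) = waring R m := by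
  unfold waring
  congr 1
  ext g
  refine exists_congr fun l => and_congr_right fun _ => and_congr_right fun _ => ?_
  constructor
  · rintro h b ⟨l', hb⟩
    have := h (b ^ p ^ j) ⟨l', (isSumOfNPowers_expChar_pow_iff p).2 hb⟩
    rwa [nLength_congr fun l => isSumOfNPowers_expChar_pow_iff p] at this
  · rintro h a ⟨l', ha⟩
    obtain ⟨b, rfl, hb⟩ := (isSumOfNPowers_expChar_pow_mul_iff p).1 ha
    rw [nLength_congr fun l => isSumOfNPowers_expChar_pow_iff p]
    exact h b ⟨l', hb⟩

end Frobenius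

theorem PowerSeries.exists_pow_eq_one_add_X {k : Type*} [Field k] {m : ℕ} (hm : (m : k) ≠ 0) :
    ∃ F : PowerSeries k, F ^ m = 1 + PowerSeries.X := by
  have hm0 : m ≠ 0 := by rintro rfl; simp at hm
  have hu : IsUnit (m : PowerSeries k) := by
    have := (IsUnit.mk0 _ hm).map (PowerSeries.C (R := k))
    simpa using this
  obtain ⟨F, hF, -⟩ := HenselianRing.is_henselian
    (I := (Ideal.span {PowerSeries.X} : Ideal (PowerSeries k)))
    (Polynomial.X ^ m - Polynomial.C (1 + PowerSeries.X))
    (Polynomial.monic_X_pow_sub_C _ hm0) 1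
    (by simp)
    (by simpa [Polynomial.derivative_X_pow] using
      hu.map (Ideal.Quotient.mk (Ideal.span {(PowerSeries.X : PowerSeries k)})))
  refine ⟨F, ?_⟩
  simpa [sub_eq_zero] using hF

namespace MvPowerSeries

variable {σ k : Type*} [Field k] {m : ℕ}

theorem exists_pow_eq_of_constantCoeff_eq_pow (hm : (m : k) ≠ 0) {u : MvPowerSeries σ k} {c : k}
    (hc : c ≠ 0) (hu : constantCoeff u = c ^ m) : ∃ v, v ^ m = u := by
  obtain ⟨F, hF⟩ := PowerSeries.exists_pow_eq_one_add_X hm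
  set w : MvPowerSeries σ k := C (c ^ m)⁻¹ * u - 1 with hw
  have hs : PowerSeries.HasSubst w := PowerSeries.HasSubst.of_constantCoeff_zero (by
    simp [hw, hu, hc])
  have h := congrArg (PowerSeries.substAlgHom (R := k) hs) hF
  rw [map_pow, map_add, map_one, PowerSeries.substAlgHom_X] at h
  refine ⟨C c * PowerSeries.substAlgHom (R := k) hs F, ?_⟩
  rw [mul_pow, h, hw, ← map_pow, add_sub_cancel, ← mul_assoc, ← map_mul,
    mul_inv_cancel₀ (pow_ne_zero _ hc), map_one, one_mul]

theorem isSumOfNPowers_constantCoeff {l : ℕ} {a : MvPowerSeries σ k}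
    (h : IsSumOfNPowers (MvPowerSeries σ k) m l a) :
    IsSumOfNPowers k m l (constantCoeff a) :=
  h.map _

theorem level_eq_level : level (MvPowerSeries σ k) m = level k m :=
  nLength_congr fun l => ⟨fun h => by simpa using h.map constantCoeff,
    fun h => by simpa using h.map (C (σ := σ))⟩

/-- A power series with nonzero constant coefficient has the same length as that coefficient. -/
theorem isSumOfNPowers_of_constantCoeff_ne_zero (hm : (m : k) ≠ 0) {l : ℕ}
    {a : MvPowerSeries σ k} (ha : constantCoeff a ≠ 0)
    (h : IsSumOfNPowers k m l (constantCoeff a)) :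
    IsSumOfNPowers (MvPowerSeries σ k) m l a := by
  have hm0 : m ≠ 0 := by rintro rfl; simp at hm
  obtain ⟨x, hx⟩ := h
  obtain ⟨i, hi⟩ : ∃ i, x i ≠ 0 := by
    by_contra! h0
    exact ha (by simp [hx, h0, hm0])
  obtain _ | l := l
  · exact i.elim0
  rw [Fin.sum_univ_succAbove _ i] at hx
  obtain ⟨v, hv⟩ := exists_pow_eq_of_constantCoeff_eq_pow hm (c := x i)
    (u := a - ∑ t, C (x (i.succAbove t)) ^ m) hi (by simp [hx])
  rw [← sub_add_cancel a (∑ t, C (x (i.succAbove t)) ^ m), ← hv]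
  exact IsSumOfNPowers.add_pow v ⟨_, rfl⟩

theorem isSumOfNPowers_of_constantCoeff_eq_zero (hm : (m : k) ≠ 0) {l : ℕ}
    {a : MvPowerSeries σ k} (ha : constantCoeff a = 0) (h : IsSumOfNPowers k m l (-1)) :
    IsSumOfNPowers (MvPowerSeries σ k) m (l + 1) a := by
  obtain ⟨v, hv⟩ := exists_pow_eq_of_constantCoeff_eq_pow hm (c := 1) (u := a + 1) one_ne_zero
    (by simp [ha])
  have := (h.map (C (σ := σ))).add_pow v
  simpa [hv] using this

theorem coeff_single_one_pow_eq_zero (hm : 1 < m) {f : MvPowerSeries σ k}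
    (hf : constantCoeff f = 0) (i : σ) : coeff (Finsupp.single i 1) (f ^ m) = 0 := by
  refine coeff_of_lt_order (lt_of_lt_of_le ?_ (le_order_pow_of_constantCoeff_eq_zero m hf))
  simpa using hm

theorem level_add_one_le_of_isSumOfNPowers_X (hm : 1 < m) {l : ℕ} {i : σ}
    (h : IsSumOfNPowers (MvPowerSeries σ k) m l (X i)) : level k m + 1 ≤ l := by
  obtain ⟨x, hx⟩ := h
  obtain ⟨t, ht⟩ : ∃ t, constantCoeff (x t) ≠ 0 := by
    by_contra! h0
    have := congrArg (coeff (Finsupp.single i 1)) hx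
    simp [coeff_single_one_pow_eq_zero hm, h0] at this
  obtain _ | l := l
  · exact t.elim0
  have hc := congrArg constantCoeff hx
  rw [Fin.sum_univ_succAbove _ t] at hc
  simp only [constantCoeff_X, map_add, map_pow, map_sum] at hc
  set c := constantCoeff (x t)
  have hl : 0 < l := by
    rw [Nat.pos_iff_ne_zero]
    rintro rfl
    exact pow_ne_zero m ht (by simpa using hc.symm)
  have : level k m ≤ l := nLength_le hl ⟨fun r => constantCoeff (x (t.succAbove r)) / c, by
    rw [eq_comm] at hc
    simp only [div_pow, ← Finset.sum_div]
    rw [eq_div_iff (pow_ne_zero _ ht), neg_one_mul]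
    exact (eq_neg_of_add_eq_zero_right hc).symm⟩
  push_cast
  gcongr

theorem waring_eq_max [Nonempty σ] (hm : (m : k) ≠ 0) (hm1 : 1 < m) (hl : level k m ≠ ⊤) :
    waring (MvPowerSeries σ k) m = max (waring k m) (level k m + 1) := by
  have hm0 : 0 < m := by omega
  obtain ⟨s, hs, -, h_neg⟩ := exists_nLength_eq hl
  apply le_antisymm
  · by_cases hw : waring k m = ⊤
    · simp [hw]
    obtain ⟨w, hw, hw0, h_sum⟩ := exists_waring_eq hm0 hw
    rw [level, hs, hw]
    have h_max : ((max w (s + 1) : ℕ) : ℕ∞) ≤ max (w : ℕ∞) (s + 1) := by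
      obtain h | h := max_choice w (s + 1) <;> rw [h]
      · exact le_max_left _ _
      · exact le_max_right _ _
    refine (waring_le (by omega) fun a ⟨l, ha⟩ => ?_).trans h_max
    by_cases h0 : constantCoeff a = 0
    · exact (isSumOfNPowers_of_constantCoeff_eq_zero hm h0 h_neg).mono hm0 (le_max_right _ _)
    · exact (isSumOfNPowers_of_constantCoeff_ne_zero hm h0
        (h_sum _ ⟨l, isSumOfNPowers_constantCoeff ha⟩)).mono hm0 (le_max_left _ _)
  · by_cases hw : waring (MvPowerSeries σ k) m = ⊤
    · simp [hw]
    obtain ⟨g, hg, hg0, h_sum⟩ := exists_waring_eq hm0 hw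
    rw [hg]
    refine max_le (waring_le hg0 fun a ⟨l, ha⟩ => ?_) ?_
    · simpa using isSumOfNPowers_constantCoeff (h_sum _ ⟨l, IsSumOfNPowers.map (C (σ := σ)) ha⟩)
    · obtain ⟨i⟩ := ‹Nonempty σ›
      exact level_add_one_le_of_isSumOfNPowers_X hm1 (h_sum (X i)
        ⟨_, isSumOfNPowers_of_constantCoeff_eq_zero hm (constantCoeff_X i) h_neg⟩)

end MvPowerSeries

theorem waring_one (R : Type*) [CommRing R] : waring R 1 = 1 :=
  le_antisymm (waring_le one_pos fun a _ => ⟨fun _ => a, by simp⟩) one_le_waring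

theorem IsFreePart.exists_expChar {k : Type*} [Field k] {n m : ℕ} (hn : 0 < n)
    (hm : IsFreePart (ringChar k) n m) :
    ∃ p j : ℕ, ExpChar k p ∧ n = p ^ j * m ∧ (m : k) ≠ 0 := by
  obtain ⟨h0, rfl⟩ | ⟨h0, hd, j, hj⟩ := hm
  · have := (CharP.ringChar_zero_iff_CharZero k).1 h0
    exact ⟨1, 0, inferInstance, by simp, by exact_mod_cast hn.ne'⟩
  · have hp := (CharP.char_is_prime_or_zero k (ringChar k)).resolve_right h0
    exact ⟨ringChar k, j, .prime hp, hj, fun h => hd ((CharP.cast_eq_zero_iff k _ _).1 h)⟩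

/-- Let `k` be a field, `n, s` positive integers, `m` the `char(k)`-free part
of `n`. Then `s_n(k[[x₁,…,x_s]]) = s_m(k)`, and if `s_n(k) < ∞` then
`w_n(k[[x₁,…,x_s]]) = max {w_m(k), s_m(k)+1}` if `m > 1` and `= 1` if `m = 1`. -/
theorem level_and_waring_powerSeries (k : Type*) [Field k] (n m s : ℕ)
    (hn : 0 < n) (hs : 0 < s) (hm : IsFreePart (ringChar k) n m) :
    level (MvPowerSeries (Fin s) k) n = level k m ∧
      (level k n < ⊤ →
        (1 < m → waring (MvPowerSeries (Fin s) k) n = max (waring k m) (level k m + 1)) ∧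
        (m = 1 → waring (MvPowerSeries (Fin s) k) n = 1)) := by
  obtain ⟨p, j, _, rfl, hm0⟩ := hm.exists_expChar hn
  have : ExpChar (MvPowerSeries (Fin s) k) p :=
    expChar_of_injective_ringHom MvPowerSeries.C_injective p
  have : Nonempty (Fin s) := ⟨⟨0, hs⟩⟩
  rw [level_expChar_pow_mul, level_expChar_pow_mul, waring_expChar_pow_mul]
  refine ⟨MvPowerSeries.level_eq_level, fun hl => ⟨fun hm1 =>
    MvPowerSeries.waring_eq_max hm0 hm1 hl.ne, ?_⟩⟩
  rintro rfl
  exact waring_one _
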